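/- Scaling symmetry of the time-independent spherically symmetric Poisson–Schrödinger system: Let m, ω be real constants with m ≠ 0, and let F, M, V : ℝ → ℝ be functions with F twice differentiable and M, V differentiable on (0, ∞), satisfying for all r > 0: M'(r) = 8π r² F(r)², V'(r) = M(r)/r², and (1/(2m))(F''(r) + 2F'(r)/r) = (m − ω) F(r) + m V(r) F(r). Then for any α > 0 and β > 0, the scaled functions F̄(r) = α² F(αβ r), M̄(r) = α β⁻³ M(αβ r), V̄(r) = α² β⁻² V(αβ r) together with the scaled constants m̄ = β² m and ω̄ = β² m − α² (m − ω) satisfy the same system: for all r > 0, M̄'(r) = 8π r² F̄(r)², V̄'(r) = M̄(r)/r², and (1/(2m̄))(F̄''(r) + 2F̄'(r)/r) = (m̄ − ω̄) F̄(r) + m̄ V̄(r) F̄(r). -/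

import Mathlib

open Real

theorem deriv_const_mul_comp_mul_left (c k : ℝ) (f : ℝ → ℝ) :
    deriv (fun r => c * f (k * r)) = fun r => c * k * deriv f (k * r) := by
  funext r
  rw [deriv_const_mul_field, deriv_comp_mul_left, smul_eq_mul, mul_assoc]

/-- Scaling symmetry of the time-independent spherically symmetric
Poisson–Schrödinger system. -/
theorem poisson_schrodinger_scaling
    (m ω : ℝ) (hm : m ≠ 0) (F M V : ℝ → ℝ)
    (hF : ∀ r > (0:ℝ), DifferentiableAt ℝ F r)
    (hF' : ∀ r > (0:ℝ), DifferentiableAt ℝ (deriv F) r)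
    (hM : ∀ r > (0:ℝ), DifferentiableAt ℝ M r)
    (hV : ∀ r > (0:ℝ), DifferentiableAt ℝ V r)
    (heqM : ∀ r > (0:ℝ), deriv M r = 8 * Real.pi * r ^ 2 * (F r) ^ 2)
    (heqV : ∀ r > (0:ℝ), deriv V r = M r / r ^ 2)
    (heqF : ∀ r > (0:ℝ),
      (1 / (2 * m)) * (deriv (deriv F) r + 2 * deriv F r / r)
        = (m - ω) * F r + m * V r * F r)
    (α β : ℝ) (hα : 0 < α) (hβ : 0 < β) :
    let Fb : ℝ → ℝ := fun r => α ^ 2 * F (α * β * r)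
    let Mb : ℝ → ℝ := fun r => α * β⁻¹ ^ 3 * M (α * β * r)
    let Vb : ℝ → ℝ := fun r => α ^ 2 * β⁻¹ ^ 2 * V (α * β * r)
    let mb : ℝ := β ^ 2 * m
    let ωb : ℝ := β ^ 2 * m - α ^ 2 * (m - ω)
    ∀ r > (0:ℝ),
      deriv Mb r = 8 * Real.pi * r ^ 2 * (Fb r) ^ 2 ∧
      deriv Vb r = Mb r / r ^ 2 ∧
      (1 / (2 * mb)) * (deriv (deriv Fb) r + 2 * deriv Fb r / r)
        = (mb - ωb) * Fb r + mb * Vb r * Fb r := by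
  intro Fb Mb Vb mb ωb r hr
  have hs : 0 < α * β * r := by positivity
  have hr0 : r ≠ 0 := hr.ne'
  have hα0 : α ≠ 0 := hα.ne'
  have hβ0 : β ≠ 0 := hβ.ne'
  simp only [Fb, Mb, Vb, mb, ωb, deriv_const_mul_comp_mul_left]
  refine ⟨?_, ?_, ?_⟩
  · rw [heqM _ hs]
    field_simp
  · rw [heqV _ hs]
    field_simp
  · have h := heqF _ hs
    field_simp at h ⊢
    linear_combination α * h
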